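/- Let α ∈ Δ and σ ∈ 𝓘. Then: (i) s_α ∘ σ > σ if and only if s_α σ > σ; (ii) s_α ∘ σ < σ if and only if s_α σ < σ. Moreover, if s_α σ ≠ σ s_α and s_α ∘ σ > σ, then s_α σ s_α > s_α σ > σ and s_α σ s_α > σ s_α > σ; and if s_α σ ≠ σ s_α and s_α ∘ σ < σ, then s_α σ s_α < s_α σ < σ and s_α σ s_α < σ s_α < σ. -/

import Mathlib

open scoped RealInnerProductSpace
open Classical

noncomputable section

variable (V : Type) [NormedAddCommGroup V] [InnerProductSpace ℝ V]

/-- The reflection determined by a vector `α` (the identity map if `α = 0`),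
as a linear endomorphism:  `x ↦ x - (2⟪x,α⟫/⟪α,α⟫) • α`. -/
def reflMap (α : V) : V →ₗ[ℝ] V where
  toFun x := x - (2 * ⟪x, α⟫ / ⟪α, α⟫) • α
  map_add' x y := by
    simp only [inner_add_left]
    rw [show 2 * (⟪x, α⟫ + ⟪y, α⟫) / ⟪α, α⟫
        = 2 * ⟪x, α⟫ / ⟪α, α⟫ + 2 * ⟪y, α⟫ / ⟪α, α⟫ by ring, add_smul]
    abel
  map_smul' c x := by
    simp only [real_inner_smul_left, RingHom.id_apply, smul_sub]
    rw [show 2 * (c * ⟪x, α⟫) / ⟪α, α⟫ = c * (2 * ⟪x, α⟫ / ⟪α, α⟫) by ring,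
      mul_smul]

lemma reflMap_apply (α x : V) :
    reflMap V α x = x - (2 * ⟪x, α⟫ / ⟪α, α⟫) • α := rfl

lemma reflMap_involutive (α : V) : ∀ x, reflMap V α (reflMap V α x) = x := by
  intro x
  by_cases h : (⟪α, α⟫ : ℝ) = 0
  · have h0 : α = 0 := inner_self_eq_zero.mp h
    simp [reflMap_apply, h0]
  · rw [reflMap_apply, reflMap_apply, inner_sub_left, real_inner_smul_left,
      div_mul_cancel₀ _ h]
    rw [show ⟪x, α⟫ - 2 * ⟪x, α⟫ = -⟪x, α⟫ by ring]
    rw [show 2 * -⟪x, α⟫ / ⟪α, α⟫ = -(2 * ⟪x, α⟫ / ⟪α, α⟫) by ring, neg_smul]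
    abel

/-- The reflection determined by a vector `α`, as a linear automorphism of `V`. -/
def sref (α : V) : V ≃ₗ[ℝ] V :=
  { reflMap V α with
    invFun := reflMap V α
    left_inv := reflMap_involutive V α
    right_inv := reflMap_involutive V α }

lemma sref_apply (α x : V) :
    sref V α x = x - (2 * ⟪x, α⟫ / ⟪α, α⟫) • α := rfl

variable {V}

/-- The coroot `α^∨ = 2α/⟪α,α⟫` associated with a root `α`, under the identification of the
coweight space with `V` given by the inner product. -/
def coroot (α : V) : V := (2 / ⟪α, α⟫) • α

/-- The dimension of the `(-1)`-eigenspace of a linear automorphism. -/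
def lamEig (σ : V ≃ₗ[ℝ] V) : ℕ :=
  Module.finrank ℝ (Module.End.eigenspace (σ : V →ₗ[ℝ] V) (-1))

/-- The action `s_α ∘ σ` of a simple reflection on an involution: `s_α σ` if `s_α` and `σ`
commute, and `s_α σ s_α` otherwise. -/
def circAct (α : V) (σ : V ≃ₗ[ℝ] V) : V ≃ₗ[ℝ] V :=
  if sref V α * σ = σ * sref V α then sref V α * σ else sref V α * σ * sref V α

/-- A set of pairwise orthogonal vectors. -/
def OrthSet (S : Finset V) : Prop :=
  (↑S : Set V).Pairwise fun a b => ⟪a, b⟫ = 0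

/-- The product `σ_S` of the (commuting) reflections in the elements of an orthogonal set
`S`. -/
def sigmaOf (S : Finset V) : V ≃ₗ[ℝ] V :=
  (S.toList.map (sref V)).prod

variable (V)

/-- A finite crystallographic reduced root system in the Euclidean space `V`,
together with a fixed choice of simple roots. -/
structure RSD where
  /-- The set of roots. -/
  Φ : Finset V
  /-- The set of simple roots. -/
  Δ : Finset V
  nonzero : (0 : V) ∉ Φ
  span_top : Submodule.span ℝ (Φ : Set V) = ⊤
  reduced : ∀ α ∈ Φ, ∀ c : ℝ, c • α ∈ Φ → c = 1 ∨ c = -1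
  crystal : ∀ α ∈ Φ, ∀ β ∈ Φ, ∃ n : ℤ, (n : ℝ) = 2 * ⟪β, α⟫ / ⟪α, α⟫
  reflClosed : ∀ α ∈ Φ, ∀ β ∈ Φ, sref V α β ∈ Φ
  Δ_sub : Δ ⊆ Φ
  Δ_indep : LinearIndependent ℝ (fun x : (Δ : Set V) => (x : V))
  Δ_base : ∀ α ∈ Φ, (∃ c : V → ℕ, α = ∑ γ ∈ Δ, (c γ : ℝ) • γ) ∨
      (∃ c : V → ℕ, -α = ∑ γ ∈ Δ, (c γ : ℝ) • γ)

namespace RSD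

variable {V}
variable (D : RSD V)

/-- The set of positive roots. -/
def Pos : Set V :=
  {α | α ∈ D.Φ ∧ ∃ c : V → ℕ, α = ∑ γ ∈ D.Δ, (c γ : ℝ) • γ}

/-- The set of negative roots. -/
def Neg : Set V := {α | -α ∈ D.Pos}

/-- The Weyl group, as the subgroup of `GL(V)` generated by the simple reflections. -/
def W : Subgroup (V ≃ₗ[ℝ] V) := Subgroup.closure ((fun γ => sref V γ) '' ↑D.Δ)

/-- The length of `w`: the least number of simple reflections needed to write `w` as a
product of simple reflections. -/
def length (w : V ≃ₗ[ℝ] V) : ℕ :=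
  sInf {n | ∃ l : List V, l.length = n ∧ (∀ γ ∈ l, γ ∈ D.Δ) ∧ w = (l.map (sref V)).prod}

/-- The Bruhat order on the Weyl group: `u ≤ v` iff `v` is obtained from `u` by successively
multiplying by reflections, each time increasing the length. -/
def ble (u v : V ≃ₗ[ℝ] V) : Prop :=
  Relation.ReflTransGen
    (fun x y => (∃ β ∈ D.Φ, y = sref V β * x) ∧ D.length x < D.length y) u v

/-- The strict Bruhat order. -/
def blt (u v : V ≃ₗ[ℝ] V) : Prop := D.ble u v ∧ u ≠ v

/-- The dominance order: `y - x` is a nonnegative integer combination of simple roots. -/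
def dom (x y : V) : Prop := ∃ c : V → ℕ, y - x = ∑ γ ∈ D.Δ, (c γ : ℝ) • γ

/-- The dominance order on coweights: `y - x` is a nonnegative integer combination of simple
coroots. -/
def cdom (x y : V) : Prop := ∃ c : V → ℕ, y - x = ∑ γ ∈ D.Δ, (c γ : ℝ) • coroot γ

/-- The length `L(σ) = (ℓ(σ) + λ(σ))/2` of an involution `σ`, where `λ(σ)` is the dimension
of the `(-1)`-eigenspace of `σ`. -/
def Linv (σ : V ≃ₗ[ℝ] V) : ℚ :=
  ((D.length σ : ℚ) + (lamEig σ : ℚ)) / 2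

end RSD

/-- A finite irreducible crystallographic reduced root system, with a fixed choice of simple
roots and a marked simple root `αP` whose coefficient in the highest root `θ` equals `1`
(the cominuscule case). -/
structure MRSD extends RSD V where
  irred : ¬ ∃ A B : Set V, A.Nonempty ∧ B.Nonempty ∧ A ∪ B = ↑Φ ∧
      ∀ α ∈ A, ∀ β ∈ B, ⟪α, β⟫ = 0
  /-- The marked simple root. -/
  αP : V
  αP_mem : αP ∈ Δ
  /-- The highest root. -/
  θ : V
  θ_mem : θ ∈ Φ
  θ_high : ∀ α ∈ Φ, ∃ c : V → ℕ, θ - α = ∑ γ ∈ Δ, (c γ : ℝ) • γ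
  θ_coeff : ∃ c : V → ℕ, (θ = ∑ γ ∈ Δ, (c γ : ℝ) • γ) ∧ c αP = 1

namespace MRSD

variable {V}
variable (M : MRSD V)

/-- The set `Ψ` of positive roots in which the marked simple root `αP` has coefficient `1`. -/
def Psi : Set V :=
  {α | α ∈ M.Φ ∧ ∃ c : V → ℕ, (α = ∑ γ ∈ M.Δ, (c γ : ℝ) • γ) ∧ c M.αP = 1}

/-- The set of positive roots of the subsystem `Φ_P`, i.e. the positive roots in which the
marked simple root `αP` has coefficient `0`. -/
def PosP : Set V :=
  {α | α ∈ M.Φ ∧ ∃ c : V → ℕ, (α = ∑ γ ∈ M.Δ, (c γ : ℝ) • γ) ∧ c M.αP = 0}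

/-- The parabolic subgroup `W_P` generated by the simple reflections in `Δ ∖ {αP}`. -/
def WP : Subgroup (V ≃ₗ[ℝ] V) :=
  Subgroup.closure ((fun γ => sref V γ) '' ↑(M.Δ.erase M.αP))

/-- The inversion set `Φ⁺(v) = {α ∈ Φ⁺ : v(α) ∈ Φ⁻}`. -/
def InvSet (v : V ≃ₗ[ℝ] V) : Set V := {α | α ∈ M.Pos ∧ v α ∈ M.Neg}

/-- `v` belongs to `W^P`: it lies in `W` and has minimal length in its coset `v W_P`. -/
def IsMinRep (v : V ≃ₗ[ℝ] V) : Prop :=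
  v ∈ M.W ∧ ∀ u, u ∈ M.W → v⁻¹ * u ∈ M.WP → M.length v ≤ M.length u

/-- `μ` is the minimal length representative `[w]^P` of the coset `w W_P`. -/
def IsMinRepOf (μ w : V ≃ₗ[ℝ] V) : Prop :=
  (μ ∈ M.W ∧ w⁻¹ * μ ∈ M.WP) ∧
    ∀ u, u ∈ M.W → w⁻¹ * u ∈ M.WP → M.length μ ≤ M.length u

/-- The subset `Φ_S = {α ∈ Φ : σ_S(α) = -α}` determined by an orthogonal set of roots `S`. -/
def PhiSet (S : Finset V) : Set V := {α | α ∈ M.Φ ∧ sigmaOf S α = -α}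

/-- A root is long if its squared length is maximal among the roots. -/
def IsLong (α : V) : Prop := ∀ β ∈ M.Φ, ⟪β, β⟫ ≤ ⟪α, α⟫

/-- Admissible pair: `v ∈ W^P`, `S ⊆ Ψ` a set of pairwise orthogonal roots with
`v(S) ⊆ Φ⁻`. -/
def Admissible (v : V ≃ₗ[ℝ] V) (S : Finset V) : Prop :=
  M.IsMinRep v ∧ (↑S : Set V) ⊆ M.Psi ∧ OrthSet S ∧ ∀ β ∈ S, v β ∈ M.Neg

/-- The length `L(v,S) = (ℓ(σ_{v(S)}) + |S|)/2` of an admissible pair `(v,S)`. -/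
def pairL (v : V ≃ₗ[ℝ] V) (S : Finset V) : ℚ :=
  ((M.length (sigmaOf (S.image fun x => v x)) : ℚ) + (S.card : ℚ)) / 2

end MRSD

lemma sref_sref (α x : V) : sref V α (sref V α x) = x := reflMap_involutive V α x

lemma sref_mul_self (α : V) : sref V α * sref V α = 1 :=
  LinearEquiv.ext fun x => sref_sref V α x

lemma sref_inv (α : V) : (sref V α)⁻¹ = sref V α :=
  inv_eq_of_mul_eq_one_left (sref_mul_self V α)

variable {V}

lemma sref_self {α : V} (h : α ≠ 0) : sref V α α = -α := by
  have h' : (⟪α, α⟫ : ℝ) ≠ 0 := inner_self_ne_zero.mpr h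
  rw [sref_apply, mul_div_assoc, div_self h', mul_one, two_smul]
  abel

lemma sref_neg (α : V) : sref V (-α) = sref V α := by
  ext x
  simp only [sref_apply, inner_neg_right, inner_neg_left, neg_neg, smul_neg, mul_neg, neg_div,
    neg_smul]

lemma inner_sref_sref (α x y : V) : ⟪sref V α x, sref V α y⟫ = ⟪x, y⟫ := by
  by_cases h : (⟪α, α⟫ : ℝ) = 0
  · have h0 : α = 0 := inner_self_eq_zero.mp h
    simp [sref_apply, h0]
  · simp only [sref_apply, inner_sub_left, inner_sub_right, real_inner_smul_left,
      real_inner_smul_right, real_inner_comm α y]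
    field_simp
    ring

lemma sref_map_mul {w : V ≃ₗ[ℝ] V} (hw : ∀ x y, ⟪w x, w y⟫ = ⟪x, y⟫) (β : V) :
    sref V (w β) * w = w * sref V β := by
  ext x
  simp only [LinearEquiv.mul_apply, sref_apply, hw, map_sub, map_smul]

namespace RSD

variable (D : RSD V)

/-- A word in the simple roots. -/
def IsWord (l : List V) : Prop := ∀ γ ∈ l, γ ∈ D.Δ

variable {D}

lemma ne_zero_of_mem {α : V} (h : α ∈ D.Φ) : α ≠ 0 := fun h0 => D.nonzero (h0 ▸ h)

lemma neg_mem {α : V} (h : α ∈ D.Φ) : -α ∈ D.Φ :=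
  sref_self (ne_zero_of_mem h) ▸ D.reflClosed α h α h

lemma pos_or_neg {α : V} (h : α ∈ D.Φ) : α ∈ D.Pos ∨ α ∈ D.Neg :=
  (D.Δ_base α h).imp (fun hc => ⟨h, hc⟩) (fun hc => ⟨neg_mem h, hc⟩)

lemma neg_mem_neg {α : V} (h : α ∈ D.Pos) : -α ∈ D.Neg := by
  change - -α ∈ D.Pos
  rwa [neg_neg]

lemma simple_pos {γ : V} (h : γ ∈ D.Δ) : γ ∈ D.Pos :=
  ⟨D.Δ_sub h, fun δ => if δ = γ then 1 else 0, by simp [h]⟩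

lemma coeff_eq_zero {f : V → ℝ} (h : ∑ γ ∈ D.Δ, f γ • γ = 0) : ∀ γ ∈ D.Δ, f γ = 0 := by
  have hli : LinearIndepOn ℝ id (D.Δ : Set V) := D.Δ_indep
  exact linearIndepOn_finset_iff.mp hli f h

/-- A simple reflection makes no positive root negative other than its own root. -/
lemma eq_of_sref_mem_neg {γ β : V} (hγ : γ ∈ D.Δ) (hβ : β ∈ D.Pos)
    (h : sref V γ β ∈ D.Neg) : β = γ := by
  obtain ⟨hβΦ, c, hc⟩ := hβ
  obtain ⟨-, d, hd⟩ := h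
  set k : ℝ := 2 * ⟪β, γ⟫ / ⟪γ, γ⟫ with hk
  have hsum : ∑ δ ∈ D.Δ, ((c δ : ℝ) + d δ - if δ = γ then k else 0) • δ = 0 := by
    simp only [sub_smul, add_smul, Finset.sum_sub_distrib, Finset.sum_add_distrib, ite_smul,
      zero_smul, Finset.sum_ite_eq', hγ, if_true]
    rw [← hc, ← hd, sref_apply, ← hk]
    abel
  have hz : ∀ δ ∈ D.Δ, δ ≠ γ → (c δ : ℝ) = 0 := by
    intro δ hδ hne
    have h1 := coeff_eq_zero hsum δ hδ
    rw [if_neg hne] at h1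
    have : (0 : ℝ) ≤ c δ := Nat.cast_nonneg _
    have : (0 : ℝ) ≤ d δ := Nat.cast_nonneg _
    linarith
  have hβγ : β = (c γ : ℝ) • γ := by
    rw [hc]
    refine Finset.sum_eq_single γ (fun δ hδ hne => by rw [hz δ hδ hne, zero_smul]) ?_
    exact fun h => absurd hγ h
  rcases D.reduced γ (D.Δ_sub hγ) (c γ) (hβγ ▸ hβΦ) with h1 | h1
  · rw [hβγ, h1, one_smul]
  · have : (0 : ℝ) ≤ c γ := Nat.cast_nonneg _
    linarith

lemma sref_mem_pos {γ β : V} (hγ : γ ∈ D.Δ) (hβ : β ∈ D.Pos) (h : β ≠ γ) :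
    sref V γ β ∈ D.Pos :=
  (pos_or_neg (D.reflClosed γ (D.Δ_sub hγ) β hβ.1)).resolve_right
    fun hn => h (eq_of_sref_mem_neg hγ hβ hn)

lemma not_pos_and_neg {β : V} (hp : β ∈ D.Pos) (hn : β ∈ D.Neg) : False := by
  obtain ⟨hβ, c, hc⟩ := hp
  obtain ⟨-, d, hd⟩ := hn
  have hsum : ∑ δ ∈ D.Δ, ((c δ : ℝ) + d δ) • δ = 0 := by
    simp only [add_smul, Finset.sum_add_distrib]
    rw [← hc, ← hd, add_neg_cancel]
  refine ne_zero_of_mem hβ (hc.trans (Finset.sum_eq_zero fun δ hδ => ?_))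
  have h1 := coeff_eq_zero hsum δ hδ
  have : (0 : ℝ) ≤ c δ := Nat.cast_nonneg _
  have : (0 : ℝ) ≤ d δ := Nat.cast_nonneg _
  rw [show (c δ : ℝ) = 0 by linarith, zero_smul]

/-- The strong exchange condition. -/
lemma exists_word_sref_mul {l : List V} (hl : D.IsWord l) {β : V} (hβ : β ∈ D.Pos)
    (h : (l.map (sref V)).prod⁻¹ β ∈ D.Neg) :
    ∃ l' : List V, D.IsWord l' ∧ l'.length + 1 = l.length ∧
      sref V β * (l.map (sref V)).prod = (l'.map (sref V)).prod := by
  induction l generalizing β with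
  | nil => exact (not_pos_and_neg hβ (by simpa using h)).elim
  | cons δ t ih =>
    have ht : D.IsWord t := fun γ hγ => hl γ (List.mem_cons_of_mem _ hγ)
    have hδ : δ ∈ D.Δ := hl δ List.mem_cons_self
    rw [List.map_cons, List.prod_cons]
    by_cases hβδ : β = δ
    · exact ⟨t, ht, rfl, by rw [hβδ, ← mul_assoc, sref_mul_self, one_mul]⟩
    · rw [List.map_cons, List.prod_cons, mul_inv_rev, sref_inv, LinearEquiv.mul_apply] at h
      obtain ⟨t', ht', hlen, heq⟩ := ih ht (sref_mem_pos hδ hβ hβδ) h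
      refine ⟨δ :: t', ?_, by simp [hlen], ?_⟩
      · intro γ hγ
        rcases List.mem_cons.mp hγ with rfl | hγ
        · exact hδ
        · exact ht' γ hγ
      · have hconj := sref_map_mul (inner_sref_sref δ) (sref V δ β)
        rw [sref_sref] at hconj
        rw [List.map_cons, List.prod_cons, ← heq, ← mul_assoc, ← mul_assoc, hconj]

lemma prod_reverse_word (l : List V) :
    (l.reverse.map (sref V)).prod = (l.map (sref V)).prod⁻¹ := by
  induction l with
  | nil => simp
  | cons δ t ih =>
    rw [List.reverse_cons, List.map_append, List.prod_append, ih, List.map_singleton,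
      List.prod_singleton, List.map_cons, List.prod_cons, mul_inv_rev, sref_inv]

lemma exists_word {w : V ≃ₗ[ℝ] V} (hw : w ∈ D.W) :
    ∃ l : List V, D.IsWord l ∧ w = (l.map (sref V)).prod := by
  induction hw using Subgroup.closure_induction with
  | mem x hx =>
    obtain ⟨γ, hγ, rfl⟩ := hx
    exact ⟨[γ], by simpa [IsWord] using hγ, by simp⟩
  | one => exact ⟨[], by simp [IsWord], by simp⟩
  | mul x y _ _ hx hy =>
    obtain ⟨l, hl, rfl⟩ := hx
    obtain ⟨m, hm, rfl⟩ := hy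
    exact ⟨l ++ m, fun γ hγ => (List.mem_append.mp hγ).elim (hl γ) (hm γ), by simp⟩
  | inv x _ hx =>
    obtain ⟨l, hl, rfl⟩ := hx
    exact ⟨l.reverse, fun γ hγ => hl γ (List.mem_reverse.mp hγ), (prod_reverse_word l).symm⟩

lemma length_le {l : List V} (hl : D.IsWord l) :
    D.length (l.map (sref V)).prod ≤ l.length :=
  Nat.sInf_le ⟨l, rfl, hl, rfl⟩

lemma exists_reduced_word {w : V ≃ₗ[ℝ] V} (hw : w ∈ D.W) :
    ∃ l : List V, D.IsWord l ∧ w = (l.map (sref V)).prod ∧ l.length = D.length w := by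
  obtain ⟨l₀, hl₀, hw₀⟩ := exists_word hw
  obtain ⟨l, hlen, hl, hwl⟩ := Nat.sInf_mem
    (s := {n | ∃ l : List V, l.length = n ∧ (∀ γ ∈ l, γ ∈ D.Δ) ∧ w = (l.map (sref V)).prod})
    ⟨l₀.length, l₀, rfl, hl₀, hw₀⟩
  exact ⟨l, hl, hwl, hlen⟩

lemma length_inv_le {w : V ≃ₗ[ℝ] V} (hw : w ∈ D.W) : D.length w⁻¹ ≤ D.length w := by
  obtain ⟨l, hl, rfl, hlen⟩ := exists_reduced_word hw
  rw [← hlen, ← prod_reverse_word, ← List.length_reverse]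
  exact length_le fun γ hγ => hl γ (List.mem_reverse.mp hγ)

lemma length_inv {w : V ≃ₗ[ℝ] V} (hw : w ∈ D.W) : D.length w⁻¹ = D.length w :=
  le_antisymm (length_inv_le hw) (by simpa using length_inv_le (inv_mem hw))

lemma sref_mem_W {γ : V} (hγ : γ ∈ D.Δ) : sref V γ ∈ D.W :=
  Subgroup.subset_closure ⟨γ, hγ, rfl⟩

lemma length_sref_mul_lt {w : V ≃ₗ[ℝ] V} (hw : w ∈ D.W) {β : V} (hβ : β ∈ D.Pos)
    (h : w⁻¹ β ∈ D.Neg) : D.length (sref V β * w) < D.length w := by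
  obtain ⟨l, hl, rfl, hlen⟩ := exists_reduced_word hw
  obtain ⟨l', hl', hlen', heq⟩ := exists_word_sref_mul hl hβ h
  rw [heq, ← hlen, ← hlen']
  exact Nat.lt_succ_of_le (length_le hl')

lemma length_lt_sref_mul {w : V ≃ₗ[ℝ] V} (hw : w ∈ D.W) {γ : V} (hγ : γ ∈ D.Δ)
    (h : w⁻¹ γ ∈ D.Pos) : D.length w < D.length (sref V γ * w) := by
  have := length_sref_mul_lt (mul_mem (sref_mem_W hγ) hw) (simple_pos hγ) (by
    rw [mul_inv_rev, sref_inv, LinearEquiv.mul_apply, sref_self (ne_zero_of_mem (D.Δ_sub hγ)),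
      map_neg]
    exact neg_mem_neg h)
  rwa [← mul_assoc, sref_mul_self, one_mul] at this

lemma W_isometry {w : V ≃ₗ[ℝ] V} (hw : w ∈ D.W) (x y : V) : ⟪w x, w y⟫ = ⟪x, y⟫ := by
  obtain ⟨l, -, rfl⟩ := exists_word hw
  clear hw
  induction l with
  | nil => rfl
  | cons δ t ih =>
    rw [List.map_cons, List.prod_cons, LinearEquiv.mul_apply, LinearEquiv.mul_apply,
      inner_sref_sref, ih]

lemma W_map_mem {w : V ≃ₗ[ℝ] V} (hw : w ∈ D.W) {β : V} (hβ : β ∈ D.Φ) : w β ∈ D.Φ := by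
  obtain ⟨l, hl, rfl⟩ := exists_word hw
  clear hw
  induction l with
  | nil => exact hβ
  | cons δ t ih =>
    rw [List.map_cons, List.prod_cons, LinearEquiv.mul_apply]
    exact D.reflClosed δ (D.Δ_sub (hl δ List.mem_cons_self)) _
      (ih fun γ hγ => hl γ (List.mem_cons_of_mem _ hγ))

lemma length_lt_of_blt {u v : V ≃ₗ[ℝ] V} (h : D.blt u v) : D.length u < D.length v := by
  obtain ⟨h, hne⟩ := h
  induction h with
  | refl => exact absurd rfl hne
  | @tail y z huy hyz ih =>
    by_cases huy' : u = y
    · exact huy' ▸ hyz.2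
    · exact (ih huy').trans hyz.2

lemma blt_sref_mul {w : V ≃ₗ[ℝ] V} {β : V} (hβ : β ∈ D.Φ)
    (h : D.length w < D.length (sref V β * w)) : D.blt w (sref V β * w) :=
  ⟨.single ⟨⟨β, hβ, rfl⟩, h⟩, fun he => h.ne (congrArg D.length he)⟩

lemma sref_mul_blt {w : V ≃ₗ[ℝ] V} {β : V} (hβ : β ∈ D.Φ)
    (h : D.length (sref V β * w) < D.length w) : D.blt (sref V β * w) w := by
  have := blt_sref_mul (w := sref V β * w) hβ (by rwa [← mul_assoc, sref_mul_self, one_mul])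
  rwa [← mul_assoc, sref_mul_self, one_mul] at this

lemma blt_mul_sref {w : V ≃ₗ[ℝ] V} (hw : w ∈ D.W) {β : V} (hβ : β ∈ D.Φ)
    (h : D.length w < D.length (w * sref V β)) : D.blt w (w * sref V β) := by
  rw [← sref_map_mul (W_isometry hw)] at h ⊢
  exact blt_sref_mul (W_map_mem hw hβ) h

lemma mul_sref_blt {w : V ≃ₗ[ℝ] V} (hw : w ∈ D.W) {β : V} (hβ : β ∈ D.Φ)
    (h : D.length (w * sref V β) < D.length w) : D.blt (w * sref V β) w := by
  rw [← sref_map_mul (W_isometry hw)] at h ⊢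
  exact sref_mul_blt (W_map_mem hw hβ) h

section Involution

variable {α : V} {σ : V ≃ₗ[ℝ] V}

lemma length_mul_sref_of_involution (hα : α ∈ D.Δ) (hσW : σ ∈ D.W) (hσ : σ * σ = 1) :
    D.length (σ * sref V α) = D.length (sref V α * σ) := by
  rw [← length_inv (mul_mem (sref_mem_W hα) hσW), mul_inv_rev, sref_inv,
    inv_eq_of_mul_eq_one_left hσ]

lemma inv_mul_sref_apply (hσ : σ * σ = 1) :
    (σ * sref V α)⁻¹ α = sref V α (σ α) := by
  rw [mul_inv_rev, sref_inv, inv_eq_of_mul_eq_one_left hσ, LinearEquiv.mul_apply]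

/-- If `σ α` is positive and `s_α`, `σ` do not commute, conjugating by `s_α` goes up. -/
lemma blt_of_map_pos (hα : α ∈ D.Δ) (hσW : σ ∈ D.W) (hσ : σ * σ = 1)
    (hc : sref V α * σ ≠ σ * sref V α) (h : σ α ∈ D.Pos) :
    D.blt (sref V α * σ) (sref V α * σ * sref V α) ∧ D.blt σ (sref V α * σ) ∧
      D.blt (σ * sref V α) (sref V α * σ * sref V α) ∧ D.blt σ (σ * sref V α) := by
  have hs := sref_mem_W hα
  have hαΦ := D.Δ_sub hα
  have hne : σ α ≠ α := fun he => hc (by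
    simpa only [he] using sref_map_mul (W_isometry hσW) α)
  have h1 : D.length σ < D.length (sref V α * σ) :=
    length_lt_sref_mul hσW hα (by rwa [inv_eq_of_mul_eq_one_left hσ])
  have h2 : D.length (σ * sref V α) < D.length (sref V α * (σ * sref V α)) :=
    length_lt_sref_mul (mul_mem hσW hs) hα (by
      rw [inv_mul_sref_apply hσ]
      exact sref_mem_pos hα h hne)
  have hlen := length_mul_sref_of_involution hα hσW hσ
  refine ⟨blt_mul_sref (mul_mem hs hσW) hαΦ ?_, blt_sref_mul hαΦ h1, ?_,
    blt_mul_sref hσW hαΦ (hlen ▸ h1)⟩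
  · rwa [mul_assoc, ← hlen]
  · rw [mul_assoc]
    exact blt_sref_mul hαΦ h2

/-- If `σ α` is negative and `s_α`, `σ` do not commute, conjugating by `s_α` goes down. -/
lemma blt_of_map_neg (hα : α ∈ D.Δ) (hσW : σ ∈ D.W) (hσ : σ * σ = 1)
    (hc : sref V α * σ ≠ σ * sref V α) (h : σ α ∈ D.Neg) :
    D.blt (sref V α * σ * sref V α) (sref V α * σ) ∧ D.blt (sref V α * σ) σ ∧
      D.blt (sref V α * σ * sref V α) (σ * sref V α) ∧ D.blt (σ * sref V α) σ := by
  have hs := sref_mem_W hα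
  have hαΦ := D.Δ_sub hα
  have hne : -σ α ≠ α := fun he => hc (by
    have := sref_map_mul (W_isometry hσW) α
    rwa [← sref_neg, he] at this)
  have h1 : D.length (sref V α * σ) < D.length σ :=
    length_sref_mul_lt hσW (simple_pos hα) (by rwa [inv_eq_of_mul_eq_one_left hσ])
  have h2 : D.length (sref V α * (σ * sref V α)) < D.length (σ * sref V α) :=
    length_sref_mul_lt (mul_mem hσW hs) (simple_pos hα) (by
      rw [inv_mul_sref_apply hσ, ← neg_neg (sref V α (σ α)), ← map_neg]
      exact neg_mem_neg (sref_mem_pos hα h hne))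
  have hlen := length_mul_sref_of_involution hα hσW hσ
  refine ⟨mul_sref_blt (mul_mem hs hσW) hαΦ ?_, sref_mul_blt hαΦ h1, ?_,
    mul_sref_blt hσW hαΦ (hlen ▸ h1)⟩
  · rwa [mul_assoc, ← hlen]
  · rw [mul_assoc]
    exact sref_mul_blt hαΦ h2

end Involution

end RSD

/-- Let `α ∈ Δ` and `σ ∈ 𝓘` an involution of the Weyl group.  Then
(i) `s_α ∘ σ > σ ↔ s_α σ > σ`; (ii) `s_α ∘ σ < σ ↔ s_α σ < σ`.  Moreover if
`s_α σ ≠ σ s_α` and `s_α ∘ σ > σ` then `s_α σ s_α > s_α σ > σ` and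
`s_α σ s_α > σ s_α > σ`; and if `s_α σ ≠ σ s_α` and `s_α ∘ σ < σ` then
`s_α σ s_α < s_α σ < σ` and `s_α σ s_α < σ s_α < σ`. -/
theorem statement7 {V : Type} [NormedAddCommGroup V] [InnerProductSpace ℝ V]
    [FiniteDimensional ℝ V]
    (D : RSD V) (α : V) (hα : α ∈ D.Δ)
    (σ : V ≃ₗ[ℝ] V) (hσW : σ ∈ D.W) (hσ : σ * σ = 1) :
    (D.blt σ (circAct α σ) ↔ D.blt σ (sref V α * σ)) ∧
    (D.blt (circAct α σ) σ ↔ D.blt (sref V α * σ) σ) ∧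
    (sref V α * σ ≠ σ * sref V α → D.blt σ (circAct α σ) →
      (D.blt (sref V α * σ) (sref V α * σ * sref V α) ∧ D.blt σ (sref V α * σ) ∧
       D.blt (σ * sref V α) (sref V α * σ * sref V α) ∧ D.blt σ (σ * sref V α))) ∧
    (sref V α * σ ≠ σ * sref V α → D.blt (circAct α σ) σ →
      (D.blt (sref V α * σ * sref V α) (sref V α * σ) ∧ D.blt (sref V α * σ) σ ∧
       D.blt (sref V α * σ * sref V α) (σ * sref V α) ∧ D.blt (σ * sref V α) σ)) := by
  by_cases hc : sref V α * σ = σ * sref V α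
  · have hcirc : circAct α σ = sref V α * σ := if_pos hc
    rw [hcirc]
    exact ⟨Iff.rfl, Iff.rfl, fun h => absurd hc h, fun h => absurd hc h⟩
  have hcirc : circAct α σ = sref V α * σ * sref V α := if_neg hc
  rw [hcirc]
  rcases RSD.pos_or_neg (RSD.W_map_mem hσW (D.Δ_sub hα)) with h | h
  · have hb := RSD.blt_of_map_pos hα hσW hσ hc h
    have h1 := RSD.length_lt_of_blt hb.2.1
    have h2 := h1.trans (RSD.length_lt_of_blt hb.1)
    exact ⟨⟨fun _ => hb.2.1, fun _ => ⟨hb.2.1.1.trans hb.1.1, fun he =>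
        h2.ne (congrArg D.length he)⟩⟩,
      ⟨fun h' => absurd (RSD.length_lt_of_blt h') h2.asymm,
        fun h' => absurd (RSD.length_lt_of_blt h') h1.asymm⟩,
      fun _ _ => hb, fun _ h' => absurd (RSD.length_lt_of_blt h') h2.asymm⟩
  · have hb := RSD.blt_of_map_neg hα hσW hσ hc h
    have h1 := RSD.length_lt_of_blt hb.2.1
    have h2 := (RSD.length_lt_of_blt hb.1).trans h1
    exact ⟨⟨fun h' => absurd (RSD.length_lt_of_blt h') h2.asymm,
        fun h' => absurd (RSD.length_lt_of_blt h') h1.asymm⟩,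
      ⟨fun _ => hb.2.1, fun _ => ⟨hb.1.1.trans hb.2.1.1, fun he =>
        h2.ne (congrArg D.length he)⟩⟩,
      fun _ h' => absurd (RSD.length_lt_of_blt h') h2.asymm, fun _ _ => hb⟩
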